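/- arXiv:1212.5356 — 8 statements merged into one kernel-verified Lean document; each statement's English description precedes it below -/
import Mathlib

section
/- Let P be a finite (3+1)-free poset and let a, b be vertices of P. If a ⊤⊤ b (the strict downsets D_a and D_b are incomparable under inclusion), then U_a = U_b. Dually, if a ⊥⊥ b (the strict upsets U_a and U_b are incomparable under inclusion), then D_a = D_b. -/
/-- Two elements of a poset are incomparable. -/
def Incomp {β : Type*} [PartialOrder β] (x y : β) : Prop := ¬ x ≤ y ∧ ¬ y ≤ x

/-- A poset is `(3+1)`-free if it contains no induced subposet consisting of a
3-element chain together with an incomparable extra element. -/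
def ThreePlusOneFree (α : Type*) [PartialOrder α] : Prop :=
  ¬ ∃ a b c d : α, a < b ∧ b < c ∧ Incomp d a ∧ Incomp d b ∧ Incomp d c

variable {α : Type*} [PartialOrder α]

/-- The strict downset `D_a` of a vertex. -/
def Dset (a : α) : Set α := {x | x < a}

/-- The strict upset `U_a` of a vertex. -/
def Uset (a : α) : Set α := {x | a < x}

/-- `a ⊤⊤ b` : the strict downsets of `a` and `b` are incomparable under inclusion. -/
def TTrel (a b : α) : Prop := ¬ Dset a ⊆ Dset b ∧ ¬ Dset b ⊆ Dset a

/-- `a ⊥⊥ b` : the strict upsets of `a` and `b` are incomparable under inclusion. -/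
def BBrel (a b : α) : Prop := ¬ Uset a ⊆ Uset b ∧ ¬ Uset b ⊆ Uset a

/-- The view `v(a) = (D_a, P \ U_a)` of a vertex, an element of `Set α × Set α`
with the componentwise inclusion order; note `v(a) ≤ v(b) ↔ D_a ⊆ D_b ∧ U_b ⊆ U_a`. -/
def view (a : α) : Set α × Set α := (Dset a, (Uset a)ᶜ)

/-- A top of a tangle: a connected component, with at least two vertices, of the graph
on the vertices of `P` with edge relation `⊤⊤`. -/
def IsTopOfTangle (A : Set α) : Prop :=
  2 ≤ A.ncard ∧ ∃ a, A = {b | Relation.ReflTransGen TTrel a b}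

/-- A bottom of a tangle: a connected component, with at least two vertices, of the graph
on the vertices of `P` with edge relation `⊥⊥`. -/
def IsBottomOfTangle (B : Set α) : Prop :=
  2 ≤ B.ncard ∧ ∃ b, B = {a | Relation.ReflTransGen BBrel b a}

/-- A top of a tangle `A` and a bottom of a tangle `B` are matched when they contain the
top and bottom pairs of an induced `(2+2)` subposet. -/
def Matched (A B : Set α) : Prop :=
  ∃ a ∈ A, ∃ a' ∈ A, ∃ b ∈ B, ∃ b' ∈ B,
    b < a ∧ b' < a' ∧ Incomp a a' ∧ Incomp b b' ∧ Incomp a b' ∧ Incomp a' b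

/-- A tangle, regarded as a vertex set: the union of a matched top and bottom. -/
def IsTangle (X : Set α) : Prop :=
  ∃ A B : Set α, IsTopOfTangle A ∧ IsBottomOfTangle B ∧ Matched A B ∧ X = A ∪ B

/-- A vertex lying in no top of a tangle and no bottom of a tangle. -/
def NotInTanglePart (a : α) : Prop :=
  (∀ A : Set α, IsTopOfTangle A → a ∉ A) ∧ (∀ B : Set α, IsBottomOfTangle B → a ∉ B)

/-- A clone set: an equivalence class under "same view" of the vertices lying in no
top or bottom of a tangle. -/
def IsCloneSet (C : Set α) : Prop :=
  ∃ a : α, NotInTanglePart a ∧ C = {b | NotInTanglePart b ∧ view b = view a}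

/-- The parts of a `(3+1)`-free poset: its clone sets and its tangles. -/
def IsPart (X : Set α) : Prop := IsCloneSet X ∨ IsTangle X

/-- The level `ℓ(a)` of a vertex: the maximum number of elements in a chain of `P`
whose greatest element is `a`. -/
noncomputable def level (a : α) : ℕ :=
  sSup {n | ∃ s : Finset α, s.card = n ∧ IsChain (· ≤ ·) (↑s : Set α) ∧ a ∈ s ∧ ∀ x ∈ s, x ≤ a}

/-- A compatible listing of the parts of a `(3+1)`-free poset: an enumeration
`X_1, …, X_k` (each part listed exactly once) such that for vertices in distinct parts,
`a < b` holds exactly when `ℓ(a) ≤ ℓ(b) - 2`, or `ℓ(a) = ℓ(b) - 1` and `i < j`. -/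
noncomputable def CompatibleListing {k : ℕ} (X : Fin k → Set α) : Prop :=
  Function.Injective X ∧ (∀ Y : Set α, IsPart Y ↔ ∃ i, X i = Y) ∧
    ∀ i j : Fin k, i ≠ j → ∀ a ∈ X i, ∀ b ∈ X j,
      (a < b ↔ (level a + 2 ≤ level b ∨ (level a + 1 = level b ∧ i < j)))

theorem TTrel.symm {a b : α} (hab : TTrel a b) : TTrel b a := ⟨hab.2, hab.1⟩

theorem BBrel.symm {a b : α} (hab : BBrel a b) : BBrel b a := ⟨hab.2, hab.1⟩

theorem TTrel.uset_subset (h : ThreePlusOneFree α) {a b : α} (hab : TTrel a b) :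
    Uset a ⊆ Uset b := by
  intro z hz
  obtain ⟨x, hxa, hxb⟩ := Set.not_subset.1 hab.1
  obtain ⟨y, hyb, hya⟩ := Set.not_subset.1 hab.2
  simp only [Dset, Uset, Set.mem_ofPred_eq] at *
  have hba : ¬ b ≤ a := fun hle => hya (hyb.trans_le hle)
  by_contra hbz
  refine h ⟨x, a, z, b, hxa, hz, ⟨fun hbx => hba (hbx.trans hxa.le), fun hle => ?_⟩,
    ⟨hba, fun hle => hxb (hxa.trans_le hle)⟩, ⟨fun hle => ?_, fun hzb => ?_⟩⟩
  · rcases hle.eq_or_lt with rfl | hlt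
    exacts [hba hxa.le, hxb hlt]
  · rcases hle.eq_or_lt with rfl | hlt
    exacts [hxb (hxa.trans hz), hbz hlt]
  · exact hxb (hxa.trans (hz.trans_le hzb))

theorem BBrel.dset_subset (h : ThreePlusOneFree α) {a b : α} (hab : BBrel a b) :
    Dset a ⊆ Dset b := by
  intro z hz
  obtain ⟨x, hax, hbx⟩ := Set.not_subset.1 hab.1
  obtain ⟨y, hby, hay⟩ := Set.not_subset.1 hab.2
  simp only [Dset, Uset, Set.mem_ofPred_eq] at *
  have hle_ab : ¬ a ≤ b := fun hle => hay (hle.trans_lt hby)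
  by_contra hzb
  refine h ⟨z, a, x, b, hz, hax, ⟨fun hbz => ?_, fun hle => ?_⟩,
    ⟨fun hle => hbx (hle.trans_lt hax), hle_ab⟩,
    ⟨fun hle => ?_, fun hxb => hle_ab (hax.le.trans hxb)⟩⟩
  · exact hbx (hbz.trans_lt (hz.trans hax))
  · rcases hle.eq_or_lt with rfl | hlt
    exacts [hbx (hz.trans hax), hzb hlt]
  · rcases hle.eq_or_lt with rfl | hlt
    exacts [hle_ab hax.le, hbx hlt]

/-- In a finite `(3+1)`-free poset, if `a ⊤⊤ b` then `U_a = U_b`;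
dually, if `a ⊥⊥ b` then `D_a = D_b`. -/
theorem tt_implies_equal_upsets {α : Type*} [Fintype α] [PartialOrder α]
    (h : ThreePlusOneFree α) (a b : α) :
    (TTrel a b → Uset a = Uset b) ∧ (BBrel a b → Dset a = Dset b) := by
  exact ⟨fun hab => (hab.uset_subset h).antisymm (hab.symm.uset_subset h),
    fun hab => (hab.dset_subset h).antisymm (hab.symm.dset_subset h)⟩
end

section
/- Let P be a finite (3+1)-free poset and let a, b be vertices of P. The views v(a) and v(b) are incomparable in the view poset if and only if a ⊤⊤ b or a ⊥⊥ b. -/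
variable {α : Type*} [PartialOrder α]

/-- In a `(3+1)`-free poset, the downsets and upsets of two vertices cannot both fail to be
included in the same direction. -/
theorem ThreePlusOneFree.dset_subset_or_uset_subset {α : Type*} [PartialOrder α]
    (h : ThreePlusOneFree α) (a b : α) : Dset a ⊆ Dset b ∨ Uset a ⊆ Uset b := by
  by_contra! hc
  obtain ⟨hD, hU⟩ := hc
  obtain ⟨x, hxa : x < a, hxb : ¬ x < b⟩ := Set.not_subset.1 hD
  obtain ⟨y, hay : a < y, hby : ¬ b < y⟩ := Set.not_subset.1 hU
  have not_le_b {z : α} (hz : x < z) : ¬ z ≤ b := fun hzb => hxb (hz.trans_le hzb)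
  have not_b_le {z : α} (hz : z < y) : ¬ b ≤ z := fun hbz => hby (hbz.trans_lt hz)
  have hxy := hxa.trans hay
  refine h ⟨x, a, y, b, hxa, hay, ⟨not_b_le hxy, fun hle => ?_⟩,
    ⟨not_b_le hay, not_le_b hxa⟩, ⟨fun hle => ?_, not_le_b hxy⟩⟩
  · exact hle.lt_or_eq.elim hxb fun he => hby (he ▸ hxy)
  · exact hle.lt_or_eq.elim hby fun he => hxb (he ▸ hxy)

theorem view_le_view_iff {α : Type*} [PartialOrder α] (a b : α) :
    view a ≤ view b ↔ Dset a ⊆ Dset b ∧ Uset b ⊆ Uset a :=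
  and_congr Iff.rfl Set.compl_subset_compl

/-- In a finite `(3+1)`-free poset, the views `v(a)` and `v(b)` are
incomparable (in the componentwise inclusion order on pairs of sets, which restricts to
the view poset) if and only if `a ⊤⊤ b` or `a ⊥⊥ b`. -/
theorem views_incomparable_iff {α : Type*} [Fintype α] [PartialOrder α]
    (h : ThreePlusOneFree α) (a b : α) :
    Incomp (view a) (view b) ↔ (TTrel a b ∨ BBrel a b) := by
  have hab := h.dset_subset_or_uset_subset a b
  have hba := h.dset_subset_or_uset_subset b a
  rw [Incomp, view_le_view_iff, view_le_view_iff, TTrel, BBrel]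
  tauto
end

section
/- Let P be a finite (3+1)-free poset and let a, b, c be any vertices of P. It is not the case that both a ⊤⊤ b and b ⊥⊥ c hold. -/
variable {α : Type*} [PartialOrder α]

/-- In a `(3+1)`-free poset every element is comparable to some member of a given
3-element chain. -/
theorem ThreePlusOneFree.comparable_of_chain {α : Type*} [PartialOrder α]
    (h : ThreePlusOneFree α) {x y z d : α} (hxy : x < y) (hyz : y < z) :
    d ≤ x ∨ x ≤ d ∨ d ≤ y ∨ y ≤ d ∨ d ≤ z ∨ z ≤ d := by
  by_contra! hd
  obtain ⟨h1, h2, h3, h4, h5, h6⟩ := hd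
  exact h ⟨x, y, z, d, hxy, hyz, ⟨h1, h2⟩, ⟨h3, h4⟩, ⟨h5, h6⟩⟩

/-- In a finite `(3+1)`-free poset, it is not the case that both
`a ⊤⊤ b` and `b ⊥⊥ c` hold. -/
theorem not_tt_and_bb {α : Type*} [Fintype α] [PartialOrder α]
    (h : ThreePlusOneFree α) (a b c : α) :
    ¬ (TTrel a b ∧ BBrel b c) := by
  rintro ⟨⟨hab, hba⟩, hbc, hcb⟩
  obtain ⟨x, hxa : x < a, hxb : ¬ x < b⟩ := Set.not_subset.1 hab
  obtain ⟨y, hyb : y < b, hya : ¬ y < a⟩ := Set.not_subset.1 hba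
  obtain ⟨z, hbz : b < z, hcz : ¬ c < z⟩ := Set.not_subset.1 hbc
  obtain ⟨w, hcw : c < w, hbw : ¬ b < w⟩ := Set.not_subset.1 hcb
  have hyc : y < c := by
    have := h.comparable_of_chain (d := c) hyb hbz
    grind [le_iff_lt_or_eq]
  have haw : a < w := by
    have := h.comparable_of_chain (d := a) hyc hcw
    grind [le_iff_lt_or_eq]
  have := h.comparable_of_chain (d := b) hxa haw
  grind [le_iff_lt_or_eq]
end

section
/- Let P be a finite (3+1)-free poset and let a, b be vertices with a ⊤⊤ b. Then there exist vertices c, d of P such that a, b, c, d are pairwise distinct, c < a, d < b, and the four pairs (a,b), (c,d), (a,d), (b,c) are each incomparable; in other words, {a, b, c, d} induces a (2+2) subposet of P with a and b as its two maximal elements. -/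
variable {α : Type*} [PartialOrder α]

/-- In a finite `(3+1)`-free poset, if `a ⊤⊤ b` then there exist `c, d`
such that `a, b, c, d` are pairwise distinct, `c < a`, `d < b`, and the pairs `(a,b)`,
`(c,d)`, `(a,d)`, `(b,c)` are each incomparable; i.e. `{a,b,c,d}` induces a `(2+2)`
subposet with `a` and `b` as its two maximal elements. -/
theorem tt_gives_two_plus_two {α : Type*} [Fintype α] [PartialOrder α]
    (h : ThreePlusOneFree α) (a b : α) (hab : TTrel a b) :
    ∃ c d : α, a ≠ b ∧ a ≠ c ∧ a ≠ d ∧ b ≠ c ∧ b ≠ d ∧ c ≠ d ∧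
      c < a ∧ d < b ∧ Incomp a b ∧ Incomp c d ∧ Incomp a d ∧ Incomp b c := by
  have hlt : ∀ {x y z : α}, x < y → ¬ x < z → Incomp y z → Incomp z x := by
    intro x y z hxy hxz hyz
    refine ⟨fun hzx => hyz.2 (hzx.trans hxy.le), fun hle => ?_⟩
    rcases hle.lt_or_eq with hlt | rfl
    · exact hxz hlt
    · exact hyz.2 hxy.le
  obtain ⟨hab₁, hab₂⟩ := hab
  have hinc : Incomp a b :=
    ⟨fun hle => hab₁ fun _ hx => lt_of_lt_of_le hx hle,
      fun hle => hab₂ fun _ hx => lt_of_lt_of_le hx hle⟩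
  obtain ⟨c, hca, hcb⟩ := Set.not_subset.mp hab₁
  obtain ⟨d, hdb, hda⟩ := Set.not_subset.mp hab₂
  have had : Incomp a d := hlt hdb hda ⟨hinc.2, hinc.1⟩
  have hbc : Incomp b c := hlt hca hcb hinc
  have hcd : Incomp c d :=
    ⟨fun hle => hcb (lt_of_le_of_lt hle hdb), fun hle => hda (lt_of_le_of_lt hle hca)⟩
  exact ⟨c, d, fun e => hinc.1 e.le, ne_of_gt hca, fun e => had.1 e.le, fun e => hbc.1 e.le,
    ne_of_gt hdb, fun e => hcd.1 e.le, hca, hdb, hinc, hcd, had, hbc⟩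
end

section
/- In a finite (3+1)-free poset P, the matching relation between tops of tangles and bottoms of tangles is a perfect matching: every top of a tangle is matched to exactly one bottom of a tangle, and every bottom of a tangle is matched to exactly one top of a tangle. -/
variable {α : Type*} [PartialOrder α]

/-- `b, b'` witness that the `r`-predecessors of `a` and `a'` are incomparable under inclusion. -/
def Cross {α : Type*} (r : α → α → Prop) (a a' b b' : α) : Prop :=
  r b a ∧ r b' a' ∧ ¬ r b' a ∧ ¬ r b a'

/-- The sets of `r`-predecessors of `a` and `a'` are incomparable under inclusion. -/
def CrossRel {α : Type*} (r : α → α → Prop) (a a' : α) : Prop :=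
  ∃ b b', Cross r a a' b b'

section Cross

variable {α : Type*} {r : α → α → Prop} {a a' b b' c c' d d' : α}

theorem Cross.symm (h : Cross r a a' b b') : Cross r a' a b' b :=
  ⟨h.2.1, h.1, h.2.2.2, h.2.2.1⟩

theorem Cross.flip (h : Cross r a a' b b') : Cross (flip r) b b' a a' :=
  ⟨h.1, h.2.1, h.2.2.2, h.2.2.1⟩

theorem Cross.crossRel (h : Cross r a a' b b') : CrossRel r a a' := ⟨b, b', h⟩

theorem CrossRel.symm (h : CrossRel r a a') : CrossRel r a' a := by
  obtain ⟨b, b', h⟩ := h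
  exact ⟨b', b, h.symm⟩

instance : Std.Symm (CrossRel r) := ⟨fun _ _ h => h.symm⟩

theorem Cross.reflTransGen_of_left_eq (h : Cross r a a' b b') (k : Cross r a c d d') :
    Relation.ReflTransGen (CrossRel (_root_.flip r)) b d := by
  by_cases hd : r d a'
  · by_cases hb : r b c
    · exact .single ⟨c, a', hb, hd, h.2.2.2, k.2.2.2⟩
    · have hbd : Cross r a c b d' := ⟨h.1, k.2.1, k.2.2.1, hb⟩
      exact (Relation.ReflTransGen.single hbd.flip.crossRel).tail k.flip.crossRel.symm
  · have hdb : Cross r a a' d b' := ⟨k.1, h.2.1, h.2.2.1, hd⟩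
    exact (Relation.ReflTransGen.single h.flip.crossRel).tail hdb.flip.crossRel.symm

theorem Cross.reflTransGen_of_reflTransGen (hac : Relation.ReflTransGen (CrossRel r) a c)
    (h : Cross r a a' b b') (k : Cross r c c' d d') :
    Relation.ReflTransGen (CrossRel (_root_.flip r)) b d := by
  induction hac using Relation.ReflTransGen.head_induction_on generalizing a' b b' with
  | refl => exact h.reflTransGen_of_left_eq k
  | head hax _ ih =>
    obtain ⟨e, e', he⟩ := hax
    exact ((h.reflTransGen_of_left_eq he).tail he.flip.crossRel).trans (ih he.symm)

theorem Cross.left_ne (h : Cross r a a' b b') : a ≠ a' := by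
  rintro rfl
  exact h.2.2.2 h.1

/-- Each nontrivial component of `CrossRel r` is joined by a crossing to exactly one nontrivial
component of `CrossRel (flip r)`. -/
theorem existsUnique_crossing_component [Finite α] {A : Set α} (hA : 2 ≤ A.ncard)
    (hcomp : ∃ a, A = {x | Relation.ReflTransGen (CrossRel r) a x}) :
    ∃! B : Set α, (2 ≤ B.ncard ∧
        ∃ b, B = {x | Relation.ReflTransGen (CrossRel (flip r)) b x}) ∧
      ∃ a ∈ A, ∃ a' ∈ A, ∃ b ∈ B, ∃ b' ∈ B, Cross r a a' b b' := by
  obtain ⟨a, rfl⟩ := hcomp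
  obtain ⟨x, hx, hxa⟩ := Set.exists_ne_of_one_lt_ncard hA a
  obtain ⟨a', ⟨b, b', h⟩, -⟩ :=
    (Relation.ReflTransGen.cases_head (r := CrossRel r) hx).resolve_left (Ne.symm hxa)
  refine ⟨{x | Relation.ReflTransGen (CrossRel (flip r)) b x}, ⟨⟨?_, b, rfl⟩,
    a, .refl, a', .single h.crossRel, b, .refl, b', .single h.flip.crossRel, h⟩, ?_⟩
  · rw [← Set.ncard_pair h.flip.left_ne]
    refine Set.ncard_le_ncard ?_ (Set.toFinite _)
    rintro y (rfl | rfl)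
    · exact .refl
    · exact .single h.flip.crossRel
  · rintro _ ⟨⟨-, d, rfl⟩, c, hc, c', -, e, he, e', -, k⟩
    have hbe : Relation.ReflTransGen (CrossRel (flip r)) b e :=
      h.reflTransGen_of_reflTransGen hc k
    have hbd := hbe.trans (symm_of (Relation.ReflTransGen _) he)
    ext y
    exact ⟨hbd.trans, (symm_of (Relation.ReflTransGen _) hbd).trans⟩

end Cross

theorem TTrel_eq_crossRel : (TTrel : α → α → Prop) = CrossRel (· < ·) := by
  ext a a'
  simp only [TTrel, Dset, Set.not_subset, Set.mem_ofPred_eq, CrossRel, Cross]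
  grind

theorem BBrel_eq_crossRel : (BBrel : α → α → Prop) = CrossRel (flip (· < ·)) := by
  ext b b'
  simp only [BBrel, Uset, Set.not_subset, Set.mem_ofPred_eq, CrossRel, Cross, flip]
  grind

theorem cross_lt_iff {a a' b b' : α} :
    Cross (· < ·) a a' b b' ↔
      b < a ∧ b' < a' ∧ Incomp a a' ∧ Incomp b b' ∧ Incomp a b' ∧ Incomp a' b := by
  constructor
  · rintro ⟨h, h', hn, hn'⟩
    have haa' : ¬ a ≤ a' := fun k => hn' (h.trans_le k)
    have ha'a : ¬ a' ≤ a := fun k => hn (h'.trans_le k)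
    refine ⟨h, h', ⟨haa', ha'a⟩, ⟨fun k => hn' (k.trans_lt h'), fun k => hn (k.trans_lt h)⟩,
      ⟨fun k => haa' (k.trans h'.le), fun k => ?_⟩, ⟨fun k => ha'a (k.trans h.le), fun k => ?_⟩⟩
    · obtain rfl | k := k.eq_or_lt
      exacts [haa' h'.le, hn k]
    · obtain rfl | k := k.eq_or_lt
      exacts [ha'a h.le, hn' k]
  · rintro ⟨h, h', -, -, k, k'⟩
    exact ⟨h, h', fun l => k.2 l.le, fun l => k'.2 l.le⟩

theorem matched_iff {A B : Set α} :
    Matched A B ↔ ∃ a ∈ A, ∃ a' ∈ A, ∃ b ∈ B, ∃ b' ∈ B, Cross (· < ·) a a' b b' := by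
  simp only [Matched, cross_lt_iff]

theorem matched_iff_flip {A B : Set α} :
    Matched A B ↔
      ∃ b ∈ B, ∃ b' ∈ B, ∃ a ∈ A, ∃ a' ∈ A, Cross (flip (· < ·)) b b' a a' := by
  rw [matched_iff]
  constructor
  · rintro ⟨a, ha, a', ha', b, hb, b', hb', h⟩
    exact ⟨b, hb, b', hb', a, ha, a', ha', h.flip⟩
  · rintro ⟨b, hb, b', hb', a, ha, a', ha', h⟩
    exact ⟨a, ha, a', ha', b, hb, b', hb', h.flip⟩

/-- In a finite `(3+1)`-free poset, the matching relation between tops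
of tangles and bottoms of tangles is a perfect matching: every top of a tangle is matched
to exactly one bottom of a tangle, and every bottom of a tangle is matched to exactly one
top of a tangle. -/
theorem tangle_perfect_matching {α : Type*} [Fintype α] [PartialOrder α]
    (h : ThreePlusOneFree α) :
    (∀ A : Set α, IsTopOfTangle A → ∃! B : Set α, IsBottomOfTangle B ∧ Matched A B) ∧
    (∀ B : Set α, IsBottomOfTangle B → ∃! A : Set α, IsTopOfTangle A ∧ Matched A B) := by
  constructor
  · rintro A ⟨hA, hcomp⟩
    rw [TTrel_eq_crossRel] at hcomp
    simpa only [IsBottomOfTangle, BBrel_eq_crossRel, matched_iff] using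
      existsUnique_crossing_component hA hcomp
  · rintro B ⟨hB, hcomp⟩
    rw [BBrel_eq_crossRel] at hcomp
    simp only [IsTopOfTangle, TTrel_eq_crossRel, matched_iff_flip]
    exact existsUnique_crossing_component hB hcomp
end

section
/- Let P be a finite (3+1)-free poset and let v(P) be its poset of views. The co-connected components of v(P) can be listed as S_1, S_2, …, S_k in such a way that for every 1 ≤ i < k, every element of S_i is strictly less than every element of S_{i+1} in the view poset. -/
variable {α : Type*} [PartialOrder α]

/-- The incomparability relation on the view poset `v(P)` (the set of views of all
vertices, ordered componentwise): an edge joins two views lying in `v(P)` that are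
incomparable. -/
def ViewIncompRel (α : Type*) [PartialOrder α] (p q : Set α × Set α) : Prop :=
  p ∈ Set.range (view : α → Set α × Set α) ∧ q ∈ Set.range (view : α → Set α × Set α) ∧
    Incomp p q

/-- A co-connected component of the view poset `v(P)`: a connected component of the
incomparability graph of `v(P)`. -/
def IsCoComponent (α : Type*) [PartialOrder α] (S : Set (Set α × Set α)) : Prop :=
  ∃ p ∈ Set.range (view : α → Set α × Set α),
    S = {q | Relation.ReflTransGen (ViewIncompRel α) p q}

/-- A finite type with a strict total order can be listed increasingly. -/
theorem exists_equiv_fin_of_isStrictTotalOrder {β : Type*} [Finite β] (r : β → β → Prop)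
    [IsStrictTotalOrder β r] : ∃ (k : ℕ) (e : Fin k ≃ β), ∀ i j, i < j → r (e i) (e j) := by
  classical
  let := Fintype.ofFinite β
  let : LinearOrder β := linearOrderOfSTO r
  let e := Fintype.orderIsoFinOfCardEq β rfl
  exact ⟨_, e.toEquiv, fun _ _ hij => e.strictMono hij⟩

theorem ViewIncompRel.symm {p q : Set α × Set α} (h : ViewIncompRel α p q) :
    ViewIncompRel α q p :=
  ⟨h.2.1, h.1, h.2.2.2, h.2.2.1⟩

/-- Connectivity in the incomparability graph of the view poset is symmetric. -/
theorem reflTransGen_viewIncompRel_symm {p q : Set α × Set α}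
    (h : Relation.ReflTransGen (ViewIncompRel α) p q) :
    Relation.ReflTransGen (ViewIncompRel α) q p := by
  induction h with
  | refl => exact .refl
  | tail _ hbc ih => exact ih.head hbc.symm

theorem mem_range_view_of_reflTransGen {p q : Set α × Set α}
    (hp : p ∈ Set.range (view : α → Set α × Set α))
    (h : Relation.ReflTransGen (ViewIncompRel α) p q) :
    q ∈ Set.range (view : α → Set α × Set α) := by
  induction h with
  | refl => exact hp
  | tail _ hbc _ => exact hbc.2.1

/-- Two views that are not connected in the incomparability graph are strictly comparable. -/
theorem lt_or_gt_of_not_reflTransGen {p q : Set α × Set α}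
    (hp : p ∈ Set.range (view : α → Set α × Set α))
    (hq : q ∈ Set.range (view : α → Set α × Set α))
    (h : ¬ Relation.ReflTransGen (ViewIncompRel α) p q) : p < q ∨ q < p := by
  have hne : p ≠ q := fun e => h (e ▸ .refl)
  by_cases h₁ : p ≤ q
  · exact .inl (h₁.lt_of_ne hne)
  by_cases h₂ : q ≤ p
  · exact .inr (h₂.lt_of_ne hne.symm)
  · exact absurd (.single ⟨hp, hq, h₁, h₂⟩) h

theorem lt_of_reflTransGen_left {p p' q : Set α × Set α}
    (hq : q ∈ Set.range (view : α → Set α × Set α))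
    (h : ¬ Relation.ReflTransGen (ViewIncompRel α) p q) (hpq : p < q)
    (hp : Relation.ReflTransGen (ViewIncompRel α) p p') : p' < q := by
  induction hp with
  | refl => exact hpq
  | tail hab hbc ih =>
    refine (lt_or_gt_of_not_reflTransGen hbc.2.1 hq
      fun hcq => h ((hab.tail hbc).trans hcq)).resolve_right fun hqc => ?_
    exact hbc.2.2.1 (ih.trans hqc).le

theorem lt_of_reflTransGen_right {p q q' : Set α × Set α}
    (hp : p ∈ Set.range (view : α → Set α × Set α))
    (h : ¬ Relation.ReflTransGen (ViewIncompRel α) p q) (hpq : p < q)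
    (hq : Relation.ReflTransGen (ViewIncompRel α) q q') : p < q' := by
  induction hq with
  | refl => exact hpq
  | tail hab hbc ih =>
    refine (lt_or_gt_of_not_reflTransGen hp hbc.2.1 fun hpc =>
      h (hpc.trans (reflTransGen_viewIncompRel_symm (hab.tail hbc)))).resolve_right fun hcp => ?_
    exact hbc.2.2.2 (hcp.trans ih).le

theorem IsCoComponent.nonempty {C : Set (Set α × Set α)} (hC : IsCoComponent α C) :
    C.Nonempty := by
  obtain ⟨p, _, rfl⟩ := hC
  exact ⟨p, .refl⟩

/-- Distinct co-connected components of the view poset are strictly comparable elementwise. -/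
theorem IsCoComponent.forall_lt_or_forall_gt {C D : Set (Set α × Set α)}
    (hC : IsCoComponent α C) (hD : IsCoComponent α D) (hne : C ≠ D) :
    (∀ p ∈ C, ∀ q ∈ D, p < q) ∨ ∀ q ∈ D, ∀ p ∈ C, q < p := by
  obtain ⟨p, hp, rfl⟩ := hC
  obtain ⟨q, hq, rfl⟩ := hD
  have hpq : ¬ Relation.ReflTransGen (ViewIncompRel α) p q := fun hpq =>
    hne <| Set.ext fun _ => ⟨(reflTransGen_viewIncompRel_symm hpq).trans, hpq.trans⟩
  have all_lt {p q : Set α × Set α} (hp : p ∈ Set.range (view : α → Set α × Set α))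
      (hq : q ∈ Set.range (view : α → Set α × Set α))
      (hpq : ¬ Relation.ReflTransGen (ViewIncompRel α) p q) (hlt : p < q) :
      ∀ p' ∈ {x | Relation.ReflTransGen (ViewIncompRel α) p x},
        ∀ q' ∈ {x | Relation.ReflTransGen (ViewIncompRel α) q x}, p' < q' :=
    fun p' hp' q' hq' =>
      lt_of_reflTransGen_right (mem_range_view_of_reflTransGen hp hp')
        (fun h => hpq (hp'.trans h)) (lt_of_reflTransGen_left hq hpq hlt hp') hq'
  exact (lt_or_gt_of_not_reflTransGen hp hq hpq).imp (all_lt hp hq hpq)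
    (all_lt hq hp fun h => hpq (reflTransGen_viewIncompRel_symm h))

/-- The strict elementwise order on co-connected components of the view poset is total. -/
theorem isStrictTotalOrder_coComponent (α : Type*) [PartialOrder α] :
    IsStrictTotalOrder {C // IsCoComponent α C}
      (fun C D => ∀ p ∈ C.1, ∀ q ∈ D.1, p < q) where
  irrefl C h := by
    obtain ⟨p, hp⟩ := C.2.nonempty
    exact lt_irrefl p (h p hp p hp)
  trans C D E hCD hDE p hp r hr := by
    obtain ⟨q, hq⟩ := D.2.nonempty
    exact (hCD p hp q hq).trans (hDE q hq r hr)
  trichotomous C D hCD hDC := by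
    by_contra hne
    exact (C.2.forall_lt_or_forall_gt D.2 (Subtype.coe_ne_coe.2 hne)).elim hCD hDC

/-- In a finite `(3+1)`-free poset `P`, the co-connected components of
the view poset `v(P)` can be listed as `S_1, …, S_k` so that every element of `S_i` is
strictly less than every element of `S_{i+1}`. -/
theorem cocomponents_linearly_ordered {α : Type*} [Fintype α] [PartialOrder α]
    (h : ThreePlusOneFree α) :
    ∃ (k : ℕ) (S : Fin k → Set (Set α × Set α)),
      Function.Injective S ∧
      (∀ C, IsCoComponent α C ↔ ∃ i, S i = C) ∧
      (∀ i j : Fin k, (j : ℕ) = (i : ℕ) + 1 → ∀ p ∈ S i, ∀ q ∈ S j, p < q) := by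
  have := isStrictTotalOrder_coComponent α
  obtain ⟨k, e, he⟩ := exists_equiv_fin_of_isStrictTotalOrder
    (fun C D : {C // IsCoComponent α C} => ∀ p ∈ C.1, ∀ q ∈ D.1, p < q)
  refine ⟨k, fun i => (e i).1, Subtype.val_injective.comp e.injective, fun C => ⟨fun hC => ?_, ?_⟩,
    fun i j hij => he i j (Fin.lt_def.2 (by omega))⟩
  · exact ⟨e.symm ⟨C, hC⟩, by simp⟩
  · rintro ⟨i, rfl⟩
    exact (e i).2
end

section
/- Let P be a finite (3+1)-free poset and let a, b be vertices of P with ℓ(a) ≤ ℓ(b) − 2. Then a < b. -/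
variable {α : Type*} [PartialOrder α]

section Level

variable {β : Type*} [Fintype β] [PartialOrder β]

/-- The set of cardinalities whose supremum is `level a` is bounded above. -/
theorem bddAbove_card_chains (a : β) :
    BddAbove {n | ∃ s : Finset β, s.card = n ∧ IsChain (· ≤ ·) (↑s : Set β) ∧
      a ∈ s ∧ ∀ x ∈ s, x ≤ a} := by
  refine ⟨Fintype.card β, ?_⟩
  rintro n ⟨s, rfl, -⟩
  exact s.card_le_univ

theorem card_le_level {a : β} {s : Finset β} (hs : IsChain (· ≤ ·) (↑s : Set β))
    (ha : a ∈ s) (hle : ∀ x ∈ s, x ≤ a) : s.card ≤ level a :=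
  le_csSup (bddAbove_card_chains a) ⟨s, rfl, hs, ha, hle⟩

theorem exists_chain_card_eq_level (a : β) :
    ∃ s : Finset β, s.card = level a ∧ IsChain (· ≤ ·) (↑s : Set β) ∧
      a ∈ s ∧ ∀ x ∈ s, x ≤ a :=
  Nat.sSup_mem (s := {n | ∃ s : Finset β, s.card = n ∧ IsChain (· ≤ ·) (↑s : Set β) ∧
    a ∈ s ∧ ∀ x ∈ s, x ≤ a}) ⟨1, {a}, by simp⟩ (bddAbove_card_chains a)

theorem one_le_level (a : β) : 1 ≤ level a := by
  simpa using card_le_level (a := a) (s := {a}) (by simp) (by simp) (by simp)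

theorem level_strictMono : StrictMono (level : β → ℕ) := by
  classical
  intro x y hxy
  obtain ⟨s, hcard, hs, -, hle⟩ := exists_chain_card_eq_level x
  have hy : y ∉ s := fun hy => (hle y hy).not_gt hxy
  have hlt : ∀ z ∈ s, z ≤ y := fun z hz => (hle z hz).trans hxy.le
  have hchain : IsChain (· ≤ ·) (↑(insert y s) : Set β) := by
    rw [Finset.coe_insert]
    exact hs.insert fun z hz _ => Or.inr (hlt z hz)
  have := card_le_level hchain (Finset.mem_insert_self y s) (by simpa using hlt)
  rw [Finset.card_insert_of_notMem hy] at this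
  omega

/-- A vertex that is not minimal lies above a vertex at most one level below. -/
theorem exists_lt_level_add_one {y : β} (hy : 2 ≤ level y) :
    ∃ x < y, level y ≤ level x + 1 := by
  classical
  obtain ⟨s, hcard, hs, hys, hle⟩ := exists_chain_card_eq_level y
  have hcard' := Finset.card_erase_add_one hys
  obtain ⟨x, hx⟩ := (s.erase y).exists_maximal (Finset.card_pos.mp (by omega))
  obtain ⟨hxy, hxs⟩ := Finset.mem_erase.mp hx.prop
  refine ⟨x, (hle x hxs).lt_of_ne hxy, ?_⟩
  have hchain : IsChain (· ≤ ·) (↑(s.erase y) : Set β) :=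
    hs.mono (Finset.coe_subset.mpr (s.erase_subset y))
  have := card_le_level hchain hx.prop fun z hz =>
    (hchain.total hz hx.prop).elim id fun h => hx.le_of_ge hz h
  omega

end Level

/-- In a finite `(3+1)`-free poset, if `ℓ(a) ≤ ℓ(b) - 2`
(i.e. `ℓ(a) + 2 ≤ ℓ(b)`), then `a < b`. -/
theorem lt_of_level_le_sub_two {α : Type*} [Fintype α] [PartialOrder α]
    (h : ThreePlusOneFree α) (a b : α) (hl : level a + 2 ≤ level b) :
    a < b := by
  have ha := one_le_level a
  obtain ⟨c, hcb, hc⟩ := exists_lt_level_add_one (y := b) (by omega)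
  obtain ⟨d, hdc, hd⟩ := exists_lt_level_add_one (y := c) (by omega)
  by_contra hab
  have not_le : ∀ x, level a < level x → ¬ x ≤ a := fun x hx hxa =>
    (level_strictMono.monotone hxa).not_gt hx
  have had : ¬ a ≤ d := fun had => hab (had.trans_lt (hdc.trans hcb))
  have hda : ¬ d ≤ a := fun hda => by
    have := level_strictMono (hda.lt_of_not_ge had)
    omega
  have hba := not_le b (by omega)
  exact h ⟨d, c, b, a, hdc, hcb, ⟨had, hda⟩,
    ⟨fun hac => hab (hac.trans_lt hcb), not_le c (by omega)⟩,
    ⟨fun hle => hab (hle.lt_of_not_ge hba), hba⟩⟩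
end

section
/- Let P and Q be finite (3+1)-free posets with compatible listings (X_1, …, X_k) and (Y_1, …, Y_k) of their parts, of the same length k. Suppose that for each i one of the following holds: (a) X_i and Y_i are both clone sets, all of whose vertices lie at the same level m in P and in Q respectively, and |X_i| = |Y_i|; or (b) X_i and Y_i are both tangles whose vertices occupy the same pair of adjacent levels {m, m+1} in P and in Q respectively, and there is an order isomorphism between the induced subposets on X_i and Y_i carrying the top of the tangle X_i onto the top of the tangle Y_i. Then P and Q are isomorphic as posets. -/
variable {α : Type*} [PartialOrder α]

/-- The fibres `{x | R x a}` and `{x | R x b}` are incomparable under inclusion. -/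
def FibreIncomp {γ : Type*} (R : γ → γ → Prop) (a b : γ) : Prop :=
  ¬ (∀ x, R x a → R x b) ∧ ¬ (∀ x, R x b → R x a)

section FibreIncomp

variable {γ : Type*} {R : γ → γ → Prop}

theorem FibreIncomp.of_witnesses {a a' b b' : γ} (h₁ : R b a) (h₂ : ¬ R b a')
    (h₃ : R b' a') (h₄ : ¬ R b' a) : FibreIncomp R a a' :=
  ⟨fun h => h₂ (h _ h₁), fun h => h₄ (h _ h₃)⟩

theorem FibreIncomp.exists_witnesses {a a' : γ} (h : FibreIncomp R a a') :
    ∃ b b', R b a ∧ ¬ R b a' ∧ R b' a' ∧ ¬ R b' a := by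
  obtain ⟨h₁, h₂⟩ := h
  push Not at h₁ h₂
  obtain ⟨b, hb, hb'⟩ := h₁
  obtain ⟨c, hc, hc'⟩ := h₂
  exact ⟨b, c, hb, hb', hc, hc'⟩

theorem FibreIncomp.symm {a b : γ} (h : FibreIncomp R a b) : FibreIncomp R b a := ⟨h.2, h.1⟩

theorem reflTransGen_fibreIncomp_symm {a b : γ} (h : Relation.ReflTransGen (FibreIncomp R) a b) :
    Relation.ReflTransGen (FibreIncomp R) b a :=
  haveI : Std.Symm (FibreIncomp R) := ⟨fun _ _ => FibreIncomp.symm⟩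
  Std.Symm.symm _ _ h

theorem reflTransGen_witness_of_common_vertex {a a' a'' x y z w : γ}
    (h₁ : R x a) (h₂ : ¬ R x a') (h₃ : R y a') (h₄ : ¬ R y a)
    (h₅ : R z a') (h₆ : ¬ R z a'') (h₇ : R w a'') (h₈ : ¬ R w a') :
    Relation.ReflTransGen (FibreIncomp (flip R)) x z := by
  have mk : ∀ {p q s t : γ}, R p s → ¬ R q s → R q t → ¬ R p t →
      FibreIncomp (flip R) p q := fun h₁ h₂ h₃ h₄ => .of_witnesses (R := flip R) h₁ h₂ h₃ h₄
  have hxy := mk h₁ h₄ h₃ h₂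
  have hwz := mk h₇ h₆ h₅ h₈
  by_cases hx : R x a''
  · exact .single (mk hx h₆ h₅ h₂)
  by_cases hz : R z a
  · by_cases hy : R y a''
    · exact (Relation.ReflTransGen.single hxy).tail (mk hy h₆ hz h₄)
    · exact ((Relation.ReflTransGen.single hxy).tail (mk h₃ h₈ h₇ hy)).tail hwz
  · exact .single (mk h₁ hz h₅ h₂)

/-- All witnesses of incomparability inside one component lie in one dual component. -/
theorem reflTransGen_witness {a a' c c' x y z w : γ}
    (hac : Relation.ReflTransGen (FibreIncomp R) a c)
    (h₁ : R x a) (h₂ : ¬ R x a') (h₃ : R y a') (h₄ : ¬ R y a)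
    (h₅ : R z c) (h₆ : ¬ R z c') (h₇ : R w c') (h₈ : ¬ R w c) :
    Relation.ReflTransGen (FibreIncomp (flip R)) x z := by
  have mk : ∀ {p q s t : γ}, R p s → ¬ R q s → R q t → ¬ R p t →
      FibreIncomp (flip R) p q := fun h₁ h₂ h₃ h₄ => .of_witnesses (R := flip R) h₁ h₂ h₃ h₄
  induction hac using Relation.ReflTransGen.head_induction_on generalizing a' x y with
  | refl =>
    exact (Relation.ReflTransGen.single (mk h₁ h₄ h₃ h₂)).trans
      (reflTransGen_witness_of_common_vertex h₃ h₄ h₁ h₂ h₅ h₆ h₇ h₈)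
  | head hab _ ih =>
    obtain ⟨p, q, hp, hp', hq, hq'⟩ := hab.exists_witnesses
    have hyp := reflTransGen_witness_of_common_vertex h₃ h₄ h₁ h₂ hp hp' hq hq'
    exact ((Relation.ReflTransGen.single (mk h₁ h₄ h₃ h₂)).trans hyp).trans
      ((Relation.ReflTransGen.single (mk hp hq' hq hp')).trans (ih hq hq' hp hp'))

theorem exists_fibreIncomp_of_two_le_ncard {S : Set γ} {s a : γ} (hcard : 2 ≤ S.ncard)
    (hS : S = {b | Relation.ReflTransGen (FibreIncomp R) s b}) (ha : a ∈ S) :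
    ∃ b ∈ S, FibreIncomp R a b := by
  obtain ⟨b, hb, hba⟩ := Set.exists_ne_of_one_lt_ncard hcard a
  subst hS
  have hab := (reflTransGen_fibreIncomp_symm ha).trans hb
  rcases Relation.ReflTransGen.cases_head hab with h | ⟨c, hac, -⟩
  · exact absurd h.symm hba
  · exact ⟨c, Relation.ReflTransGen.tail ha hac, hac⟩

theorem reflTransGen_component_eq {s t v : γ}
    (hs : Relation.ReflTransGen (FibreIncomp R) s v)
    (ht : Relation.ReflTransGen (FibreIncomp R) t v) :
    {b | Relation.ReflTransGen (FibreIncomp R) s b} =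
      {b | Relation.ReflTransGen (FibreIncomp R) t b} := by
  ext b
  exact ⟨fun h => ht.trans ((reflTransGen_fibreIncomp_symm hs).trans h),
    fun h => hs.trans ((reflTransGen_fibreIncomp_symm ht).trans h)⟩

end FibreIncomp

section Tangles

theorem isTopOfTangle_iff (A : Set α) : IsTopOfTangle A ↔ 2 ≤ A.ncard ∧
    ∃ a, A = {b | Relation.ReflTransGen (FibreIncomp ((· < ·) : α → α → Prop)) a b} := Iff.rfl

theorem isBottomOfTangle_iff (B : Set α) : IsBottomOfTangle B ↔ 2 ≤ B.ncard ∧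
    ∃ b, B = {a | Relation.ReflTransGen
      (FibreIncomp (flip ((· < ·) : α → α → Prop))) b a} := Iff.rfl

theorem IsTopOfTangle.eq_of_mem {A A' : Set α} {v : α} (hA : IsTopOfTangle A)
    (hA' : IsTopOfTangle A') (hv : v ∈ A) (hv' : v ∈ A') : A = A' := by
  rw [isTopOfTangle_iff] at hA hA'
  obtain ⟨-, s, rfl⟩ := hA
  obtain ⟨-, t, rfl⟩ := hA'
  exact reflTransGen_component_eq hv hv'

theorem IsBottomOfTangle.eq_of_mem {B B' : Set α} {v : α} (hB : IsBottomOfTangle B)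
    (hB' : IsBottomOfTangle B') (hv : v ∈ B) (hv' : v ∈ B') : B = B' := by
  rw [isBottomOfTangle_iff] at hB hB'
  obtain ⟨-, s, rfl⟩ := hB
  obtain ⟨-, t, rfl⟩ := hB'
  exact reflTransGen_component_eq hv hv'

theorem Matched.mem_bottom {A B : Set α} (hA : IsTopOfTangle A) (hB : IsBottomOfTangle B)
    (h : Matched A B) {c c' z w : α} (hc : c ∈ A)
    (h₅ : z < c) (h₆ : ¬ z < c') (h₇ : w < c') (h₈ : ¬ w < c) : z ∈ B := by
  obtain ⟨a, ha, a', -, b, hb, b', -, hba, hba', -, -, hab', ha'b⟩ := h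
  rw [isTopOfTangle_iff] at hA
  rw [isBottomOfTangle_iff] at hB
  obtain ⟨-, s, rfl⟩ := hA
  obtain ⟨-, t, rfl⟩ := hB
  exact Relation.ReflTransGen.trans hb (reflTransGen_witness (R := ((· < ·) : α → α → Prop))
    ((reflTransGen_fibreIncomp_symm ha).trans hc) hba (fun h => ha'b.2 h.le) hba'
    (fun h => hab'.2 h.le) h₅ h₆ h₇ h₈)

theorem Matched.mem_top {A B : Set α} (hA : IsTopOfTangle A) (hB : IsBottomOfTangle B)
    (h : Matched A B) {c c' z w : α} (hc : c ∈ B)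
    (h₅ : c < z) (h₆ : ¬ c' < z) (h₇ : c' < w) (h₈ : ¬ c < w) : z ∈ A := by
  obtain ⟨a, ha, a', -, b, hb, b', -, hba, hba', -, -, hab', ha'b⟩ := h
  rw [isTopOfTangle_iff] at hA
  rw [isBottomOfTangle_iff] at hB
  obtain ⟨-, s, rfl⟩ := hA
  obtain ⟨-, t, rfl⟩ := hB
  exact Relation.ReflTransGen.trans ha
    (reflTransGen_witness (R := flip ((· < ·) : α → α → Prop)) (a' := b') (y := a') (c' := c')
      (w := w) ((reflTransGen_fibreIncomp_symm hb).trans hc) hba (fun h => hab'.2 (le_of_lt h))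
      hba' (fun h => ha'b.2 (le_of_lt h)) h₅ h₆ h₇ h₈)

theorem IsTopOfTangle.exists_witnesses {A : Set α} {a : α} (hA : IsTopOfTangle A) (ha : a ∈ A) :
    ∃ a' ∈ A, ∃ b b', b < a ∧ ¬ b < a' ∧ b' < a' ∧ ¬ b' < a := by
  rw [isTopOfTangle_iff] at hA
  obtain ⟨hcard, s, hs⟩ := hA
  obtain ⟨a', ha', h⟩ := exists_fibreIncomp_of_two_le_ncard hcard hs ha
  exact ⟨a', ha', h.exists_witnesses⟩

theorem IsBottomOfTangle.exists_witnesses {B : Set α} {b : α} (hB : IsBottomOfTangle B)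
    (hb : b ∈ B) : ∃ b' ∈ B, ∃ a a', b < a ∧ ¬ b' < a ∧ b' < a' ∧ ¬ b < a' := by
  rw [isBottomOfTangle_iff] at hB
  obtain ⟨hcard, s, hs⟩ := hB
  obtain ⟨b', hb', h⟩ := exists_fibreIncomp_of_two_le_ncard hcard hs hb
  exact ⟨b', hb', h.exists_witnesses⟩

theorem matched_of_witnesses {A B : Set α} {a a' b b' : α} (ha : a ∈ A) (ha' : a' ∈ A)
    (hb : b ∈ B) (hb' : b' ∈ B) (h₁ : b < a) (h₂ : ¬ b < a') (h₃ : b' < a') (h₄ : ¬ b' < a) :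
    Matched A B := by
  refine ⟨a, ha, a', ha', b, hb, b', hb', h₁, h₃, ⟨fun h => h₂ (h₁.trans_le h),
    fun h => h₄ (h₃.trans_le h)⟩, ⟨fun h => h₂ (h.trans_lt h₃), fun h => h₄ (h.trans_lt h₁)⟩,
    ⟨fun h => h₂ (h₁.trans_le (h.trans h₃.le)), fun h => ?_⟩,
    ⟨fun h => h₄ (h₃.trans_le (h.trans h₁.le)), fun h => ?_⟩⟩
  · rcases h.lt_or_eq with h | rfl
    exacts [h₄ h, h₂ (h₁.trans h₃)]
  · rcases h.lt_or_eq with h | rfl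
    exacts [h₂ h, h₄ (h₃.trans h₁)]

theorem two_le_ncard_of_ne {γ : Type*} [Finite γ] {S : Set γ} {a b : γ} (ha : a ∈ S) (hb : b ∈ S)
    (h : a ≠ b) : 2 ≤ S.ncard :=
  (Set.one_lt_ncard (Set.toFinite S)).2 ⟨a, ha, b, hb, h⟩

theorem IsTopOfTangle.exists_matched [Finite α] {A : Set α} (hA : IsTopOfTangle A) :
    ∃ B, IsBottomOfTangle B ∧ Matched A B := by
  obtain ⟨a, ha⟩ : A.Nonempty := Set.nonempty_of_ncard_ne_zero (by have := hA.1; omega)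
  obtain ⟨a', ha', b, b', h₁, h₂, h₃, h₄⟩ := hA.exists_witnesses ha
  have hb' : b' ∈ {x | Relation.ReflTransGen BBrel b x} :=
    .single (FibreIncomp.of_witnesses (R := flip ((· < ·) : α → α → Prop)) h₁ h₄ h₃ h₂)
  exact ⟨_, ⟨two_le_ncard_of_ne (Set.mem_ofPred.2 .refl) hb' (fun h => h₄ (h ▸ h₁)), b, rfl⟩,
    matched_of_witnesses ha ha' (Set.mem_ofPred.2 .refl) hb' h₁ h₂ h₃ h₄⟩

theorem IsBottomOfTangle.exists_matched [Finite α] {B : Set α} (hB : IsBottomOfTangle B) :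
    ∃ A, IsTopOfTangle A ∧ Matched A B := by
  obtain ⟨b, hb⟩ : B.Nonempty := Set.nonempty_of_ncard_ne_zero (by have := hB.1; omega)
  obtain ⟨b', hb', a, a', h₁, h₂, h₃, h₄⟩ := hB.exists_witnesses hb
  have ha' : a' ∈ {x | Relation.ReflTransGen TTrel a x} :=
    .single (FibreIncomp.of_witnesses (R := ((· < ·) : α → α → Prop)) h₁ h₄ h₃ h₂)
  exact ⟨_, ⟨two_le_ncard_of_ne (Set.mem_ofPred.2 .refl) ha' (fun h => h₄ (h ▸ h₁)), a, rfl⟩,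
    matched_of_witnesses (Set.mem_ofPred.2 .refl) ha' hb hb' h₁ h₄ h₃ h₂⟩

theorem exists_isPart_mem [Finite α] (v : α) : ∃ Z : Set α, IsPart Z ∧ v ∈ Z := by
  by_cases hv : NotInTanglePart v
  · exact ⟨_, Or.inl ⟨v, hv, rfl⟩, hv, rfl⟩
  · rw [NotInTanglePart, not_and_or] at hv
    push Not at hv
    rcases hv with ⟨A, hA, hvA⟩ | ⟨B, hB, hvB⟩
    · obtain ⟨B, hB, h⟩ := hA.exists_matched
      exact ⟨A ∪ B, Or.inr ⟨A, B, hA, hB, h, rfl⟩, Or.inl hvA⟩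
    · obtain ⟨A, hA, h⟩ := hB.exists_matched
      exact ⟨A ∪ B, Or.inr ⟨A, B, hA, hB, h, rfl⟩, Or.inr hvB⟩

theorem Matched.top_eq {A A' B : Set α} (hA : IsTopOfTangle A) (hA' : IsTopOfTangle A')
    (hB : IsBottomOfTangle B) (h : Matched A B) (h' : Matched A' B) : A = A' := by
  obtain ⟨b, hb⟩ : B.Nonempty := Set.nonempty_of_ncard_ne_zero (by have := hB.1; omega)
  obtain ⟨b', -, a, a', h₁, h₂, h₃, h₄⟩ := hB.exists_witnesses hb
  exact hA.eq_of_mem hA' (h.mem_top hA hB hb h₁ h₂ h₃ h₄) (h'.mem_top hA' hB hb h₁ h₂ h₃ h₄)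

/-- A tangle whose bottom lies on one level and whose top lies on the next. -/
def IsLevelledTangle (A B : Set α) : Prop :=
  IsTopOfTangle A ∧ IsBottomOfTangle B ∧ Matched A B ∧
    ∃ m : ℕ, (∀ b ∈ B, level b = m) ∧ ∀ a ∈ A, level a = m + 1

variable {k : ℕ} {X : Fin k → Set α}

theorem CompatibleListing.notMem_of_mem_top (hX : CompatibleListing X) {i j : Fin k} (hij : i ≠ j)
    {A B : Set α} (hi : X i = A ∪ B) (hAB : IsLevelledTangle A B) {v : α} (hv : v ∈ A) :
    v ∉ X j := by
  intro hvj
  obtain ⟨hA, hB, hM, m, hmB, hmA⟩ := hAB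
  obtain ⟨a', ha', b, b', h₁, h₂, h₃, h₄⟩ := hA.exists_witnesses hv
  have hb : b ∈ B := hM.mem_bottom hA hB hv h₁ h₂ h₃ h₄
  have hb' : b' ∈ B := hM.mem_bottom hA hB ha' h₃ h₄ h₁ h₂
  have e := hX.2.2 i j hij b (hi ▸ Or.inr hb) v hvj
  have e' := hX.2.2 i j hij b' (hi ▸ Or.inr hb') v hvj
  rw [hmB b hb, ← hmB b' hb'] at e
  exact h₄ (e'.2 (e.1 h₁))

theorem CompatibleListing.eq_of_mem (hX : CompatibleListing X)
    (hparts : ∀ i, IsCloneSet (X i) ∨ ∃ A B, X i = A ∪ B ∧ IsLevelledTangle A B)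
    {i j : Fin k} {v : α} (hi : v ∈ X i) (hj : v ∈ X j) : i = j := by
  by_contra hij
  rcases hparts i with ⟨a, -, hC⟩ | ⟨A, B, hAB, hT⟩ <;>
    rcases hparts j with ⟨a', -, hC'⟩ | ⟨A', B', hAB', hT'⟩
  · apply hij
    apply hX.1
    rw [hC] at hi
    rw [hC'] at hj
    rw [hC, hC', ← hi.2, ← hj.2]
  · rw [hC] at hi
    rw [hAB'] at hj
    exact hj.elim (hi.1.1 _ hT'.1) (hi.1.2 _ hT'.2.1)
  · rw [hC'] at hj
    rw [hAB] at hi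
    exact hi.elim (hj.1.1 _ hT.1) (hj.1.2 _ hT.2.1)
  · have hi' := hi
    have hj' := hj
    rw [hAB] at hi'
    rw [hAB'] at hj'
    rcases hi' with hi' | hi'
    · exact hX.notMem_of_mem_top hij hAB hT hi' hj
    rcases hj' with hj' | hj'
    · exact hX.notMem_of_mem_top (Ne.symm hij) hAB' hT' hj' hi
    have hBB := hT.2.1.eq_of_mem hT'.2.1 hi' hj'
    subst hBB
    have hAA := hT.2.2.1.top_eq hT.1 hT'.1 hT.2.1 hT'.2.2.1
    subst hAA
    exact hij (hX.1 (hAB.trans hAB'.symm))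

theorem CompatibleListing.existsUnique_mem [Finite α] (hX : CompatibleListing X)
    (hparts : ∀ i, IsCloneSet (X i) ∨ ∃ A B, X i = A ∪ B ∧ IsLevelledTangle A B) (v : α) :
    ∃! i, v ∈ X i := by
  obtain ⟨Z, hZ, hv⟩ := exists_isPart_mem v
  obtain ⟨i, rfl⟩ := (hX.2.1 Z).1 hZ
  exact ⟨i, hv, fun j hj => hX.eq_of_mem hparts hj hv⟩

theorem IsCloneSet.not_lt {C : Set α} (hC : IsCloneSet C) {x y : α} (hx : x ∈ C) (hy : y ∈ C) :
    ¬ x < y := by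
  obtain ⟨a, -, rfl⟩ := hC
  intro hxy
  have h : Dset y = Dset x := congrArg Prod.fst (hy.2.trans hx.2.symm)
  have : x ∈ Dset x := h ▸ hxy
  exact lt_irrefl x this

variable {β : Type*} [PartialOrder β]

theorem IsCloneSet.nonempty_orderIso [Finite α] [Finite β] {C : Set α} {C' : Set β}
    (hC : IsCloneSet C) (hC' : IsCloneSet C') (h : C.ncard = C'.ncard) : Nonempty (C ≃o C') := by
  obtain ⟨e⟩ : Nonempty (C ≃ C') := Finite.card_eq.1 h
  refine ⟨e, fun {x y} => ⟨fun hxy => ?_, fun hxy => ?_⟩⟩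
  · rcases hxy.lt_or_eq with hlt | heq
    · exact absurd hlt (hC'.not_lt (e x).2 (e y).2)
    · exact (e.injective heq).le
  · rcases hxy.lt_or_eq with hlt | heq
    · exact absurd hlt (hC.not_lt x.2 y.2)
    · exact (congrArg e heq).le

/-- Order isomorphisms between the blocks of two partitions glue to a global one, provided that
the order between distinct blocks corresponds. -/
theorem nonempty_orderIso_of_blocks {ι : Type*} {X : ι → Set α} {Y : ι → Set β}
    (hX : ∀ a, ∃! i, a ∈ X i) (hY : ∀ b, ∃! i, b ∈ Y i) (e : ∀ i, X i ≃o Y i)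
    (h : ∀ i j, i ≠ j → ∀ (x : X i) (y : X j),
      ((x : α) < y ↔ ((e i x : Y i) : β) < (e j y : Y j))) : Nonempty (α ≃o β) := by
  choose p hp hp' using hX
  let f : α → β := fun a => e (p a) ⟨a, hp a⟩
  have hf : ∀ i (x : X i), f x = e i x := by
    rintro i ⟨a, ha⟩
    obtain rfl := hp' a i ha
    rfl
  have key : ∀ a b, f a ≤ f b ↔ a ≤ b := by
    intro a b
    by_cases hab : p a = p b
    · have hb : b ∈ X (p a) := hab ▸ hp b
      rw [hf (p a) ⟨a, hp a⟩, hf (p a) ⟨b, hb⟩, Subtype.coe_le_coe, (e (p a)).le_iff_le]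
      rfl
    · have hne : a ≠ b := fun h => hab (congrArg p h)
      have hne' : f a ≠ f b := fun h => hab ((hY (f a)).unique (Subtype.prop _)
        (h ▸ Subtype.prop (e (p b) ⟨b, hp b⟩)))
      rw [le_iff_lt_or_eq, le_iff_lt_or_eq, or_iff_left hne, or_iff_left hne']
      exact (h _ _ hab ⟨a, hp a⟩ ⟨b, hp b⟩).symm
  refine ⟨RelIso.ofSurjective (OrderEmbedding.ofMapLEIff f key) fun b => ?_⟩
  obtain ⟨i, hi, -⟩ := hY b
  refine ⟨(e i).symm ⟨b, hi⟩, ?_⟩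
  change f _ = b
  rw [hf, OrderIso.apply_symm_apply]

end Tangles

/-- Let `P` and `Q` be finite `(3+1)`-free posets with compatible
listings `(X_1, …, X_k)` and `(Y_1, …, Y_k)` of their parts, of the same length. Suppose
for each `i` either (a) `X_i` and `Y_i` are clone sets, all of whose vertices lie at the
same level `m` in `P` and `Q` respectively, with `|X_i| = |Y_i|`; or (b) `X_i` and `Y_i`
are tangles occupying the same pair of adjacent levels `{m, m+1}`, and there is an order
isomorphism of induced subposets carrying the top of `X_i` onto the top of `Y_i`.
Then `P ≅ Q`. -/
theorem iso_of_same_skeleton_and_parts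
    {α β : Type*} [Fintype α] [PartialOrder α] [Fintype β] [PartialOrder β]
    (hα : ThreePlusOneFree α) (hβ : ThreePlusOneFree β)
    (k : ℕ) (X : Fin k → Set α) (Y : Fin k → Set β)
    (hX : CompatibleListing X) (hY : CompatibleListing Y)
    (hparts : ∀ i : Fin k,
      -- (a) matching clone sets
      (IsCloneSet (X i) ∧ IsCloneSet (Y i) ∧
        (∃ m : ℕ, (∀ a ∈ X i, level a = m) ∧ (∀ b ∈ Y i, level b = m)) ∧
        (X i).ncard = (Y i).ncard) ∨
      -- (b) matching tangles
      (∃ (A B : Set α) (A' B' : Set β),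
        IsTopOfTangle A ∧ IsBottomOfTangle B ∧ Matched A B ∧ X i = A ∪ B ∧
        IsTopOfTangle A' ∧ IsBottomOfTangle B' ∧ Matched A' B' ∧ Y i = A' ∪ B' ∧
        (∃ m : ℕ, (∀ b ∈ B, level b = m) ∧ (∀ a ∈ A, level a = m + 1) ∧
          (∀ b ∈ B', level b = m) ∧ (∀ a ∈ A', level a = m + 1)) ∧
        (∃ e : ↥(X i) ≃o ↥(Y i), ∀ x : ↥(X i), ((x : α) ∈ A ↔ ((e x : β) ∈ A'))))) :
    Nonempty (α ≃o β) := by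
  have hX' := hX.existsUnique_mem fun i => (hparts i).imp (fun h => h.1)
    fun ⟨A, B, _, _, hA, hB, hM, hU, _, _, _, _, ⟨m, h₁, h₂, _⟩, _⟩ =>
      ⟨A, B, hU, hA, hB, hM, m, h₁, h₂⟩
  have hY' := hY.existsUnique_mem fun i => (hparts i).imp (fun h => h.2.1)
    fun ⟨_, _, A, B, _, _, _, _, hA, hB, hM, hU, ⟨m, _, _, h₁, h₂⟩, _⟩ =>
      ⟨A, B, hU, hA, hB, hM, m, h₁, h₂⟩
  have hiso : ∀ i, ∃ e : X i ≃o Y i, ∀ x : X i, level (e x : β) = level (x : α) := by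
    intro i
    rcases hparts i with ⟨hC, hC', ⟨m, hm, hm'⟩, hcard⟩ |
      ⟨A, B, A', B', -, -, -, hU, -, -, -, hU', ⟨m, hB, hA, hB', hA'⟩, e, he⟩
    · obtain ⟨e⟩ := hC.nonempty_orderIso hC' hcard
      exact ⟨e, fun x => (hm' _ (e x).2).trans (hm _ x.2).symm⟩
    · refine ⟨e, fun x => ?_⟩
      have hx : (x : α) ∈ A ∪ B := hU ▸ x.2
      have hy : (e x : β) ∈ A' ∪ B' := hU' ▸ (e x).2
      by_cases hxA : (x : α) ∈ A
      · rw [hA _ hxA, hA' _ ((he x).1 hxA)]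
      · rw [hB _ (hx.resolve_left hxA), hB' _ (hy.resolve_left fun h => hxA ((he x).2 h))]
  choose e he using hiso
  refine nonempty_orderIso_of_blocks hX' hY' e fun i j hij x y => ?_
  rw [hX.2.2 i j hij x x.2 y y.2, hY.2.2 i j hij _ (e i x).2 _ (e j y).2, he, he]
end
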